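/- Let k ≥ 2 and s ≥ 4 be integers with s even and s ≤ 2k-2, and let n ≥ 36288(⌊(s+1)/2⌋)^8. Then the unique graph on n vertices that is {K_{k+1}, L_s}-free and has maximum spectral radius among all such graphs is K_{s/2-1} ∨ (P_2 ∪ K̄_{n-s/2-1}), the join of a complete graph on s/2-1 vertices with the disjoint union of a single edge P_2 and an empty graph on n-s/2-1 vertices. -/

import Mathlib

open SimpleGraph Matrix

/-- The adjacency matrix of a simple graph, over `ℝ`. -/
noncomputable def adjMat {V : Type*} (G : SimpleGraph V) : Matrix V V ℝ :=
  fun a b => by classical exact if G.Adj a b then 1 else 0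

/-- The spectral radius of a graph: the largest (real) eigenvalue of its adjacency
matrix, expressed as the supremum of the real spectrum. -/
noncomputable def specRad {V : Type*} [Fintype V] [DecidableEq V] (G : SimpleGraph V) : ℝ :=
  sSup (spectrum ℝ (adjMat G))

/-- A linear forest: an acyclic graph in which every vertex has degree at most 2,
i.e. every connected component is a path. -/
def IsLinearForest {V : Type*} (H : SimpleGraph V) : Prop :=
  H.IsAcyclic ∧ ∀ v, {w | H.Adj v w}.ncard ≤ 2

/-- `G` contains some member of `𝓛 s`, the family of linear forests with `s` edges. -/
def ContainsLinForest {V : Type*} (G : SimpleGraph V) (s : ℕ) : Prop :=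
  ∃ H : SimpleGraph V, H ≤ G ∧ IsLinearForest H ∧ H.edgeSet.ncard = s

/-- `G` belongs to `Ex_sp(n, {K_{k+1}, 𝓛_s})`: it is `{K_{k+1}, 𝓛_s}`-free and has the
maximum spectral radius among all such graphs on `n` vertices. -/
def IsExtremal (n k s : ℕ) (G : SimpleGraph (Fin n)) : Prop :=
  G.CliqueFree (k + 1) ∧ ¬ ContainsLinForest G s ∧
    ∀ H : SimpleGraph (Fin n), H.CliqueFree (k + 1) → ¬ ContainsLinForest H s →
      specRad H ≤ specRad G

/-- The degree of `v` in `G`. -/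
noncomputable def degOf {V : Type*} (G : SimpleGraph V) (v : V) : ℕ :=
  {w | G.Adj v w}.ncard

/-- `K_a ∨ (P_2 ∪ K̄_{n-a-2})` on `Fin n`: the first `a` vertices form a clique joined to
all others; vertices `a` and `a+1` form an edge; the rest is independent. -/
def cliqueEdgeJoinEmpty (n a : ℕ) : SimpleGraph (Fin n) :=
  SimpleGraph.fromRel (fun u v => u.val < a ∨ (u.val ≤ a + 1 ∧ v.val ≤ a + 1))


set_option linter.unusedSectionVars false

section Combi
variable {V : Type*} [Fintype V] [DecidableEq V]

def LF (G : SimpleGraph V) (W : Finset V) (m : ℕ) : Prop :=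
  ∃ H : SimpleGraph V, H ≤ G ∧ IsLinearForest H ∧ H.edgeSet.ncard = m ∧ ∀ x y, H.Adj x y → x ∈ W

lemma lf_bot (G : SimpleGraph V) (W : Finset V) : LF G W 0 := by
  refine ⟨⊥, bot_le, ⟨isAcyclic_bot, ?_⟩, ?_, ?_⟩ <;> simp

lemma linforest_ext {H : SimpleGraph V} (hH : IsLinearForest H) {u v : V} (huv : u ≠ v)
    (hu : {w | H.Adj u w}.ncard ≤ 1) (hv : ∀ w, ¬ H.Adj v w) :
    IsLinearForest (H ⊔ edge u v) ∧ (H ⊔ edge u v).edgeSet.ncard = H.edgeSet.ncard + 1 := by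
  have hnr : ¬ H.Reachable u v := by
    intro h
    obtain ⟨p⟩ := h.symm
    cases p with
    | nil => exact huv rfl
    | cons h _ => exact hv _ h
  refine ⟨⟨hH.1.sup_edge_of_not_reachable hnr, ?_⟩, ?_⟩
  · intro x
    by_cases hxu : x = u
    · subst hxu
      have : {w | (H ⊔ edge x v).Adj x w} ⊆ insert v {w | H.Adj x w} := by
        intro w hw
        simp only [Set.mem_ofPred_eq, sup_adj, edge_adj, Set.mem_insert_iff] at hw ⊢
        grind
      calc _ ≤ _ := Set.ncard_le_ncard this (Set.toFinite _)
        _ ≤ _ := Set.ncard_insert_le _ _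
        _ ≤ 2 := by omega
    · by_cases hxv : x = v
      · subst hxv
        have : {w | (H ⊔ edge u x).Adj x w} ⊆ {u} := by
          intro w hw
          simp only [Set.mem_ofPred_eq, sup_adj, edge_adj, Set.mem_singleton_iff] at hw ⊢
          have := hv w
          grind
        calc _ ≤ _ := Set.ncard_le_ncard this (Set.toFinite _)
          _ ≤ 2 := by simp
      · have : {w | (H ⊔ edge u v).Adj x w} ⊆ {w | H.Adj x w} := by
          intro w hw
          simp only [Set.mem_ofPred_eq, sup_adj, edge_adj] at hw ⊢
          grind
        exact (Set.ncard_le_ncard this (Set.toFinite _)).trans (hH.2 x)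
  · have : (H ⊔ edge u v).edgeSet = insert s(u, v) H.edgeSet := by
      ext e
      induction e with | _ x y =>
      simp only [mem_edgeSet, sup_adj, edge_adj, Set.mem_insert_iff, Sym2.eq_iff]
      grind
    rw [this, Set.ncard_insert_of_notMem _ (Set.toFinite _)]
    rw [mem_edgeSet]
    exact fun h => hv u h.symm

lemma edge_le_of {G : SimpleGraph V} {u v : V} (h : G.Adj u v) : edge u v ≤ G := by
  intro x y hxy
  rw [edge_adj] at hxy
  rcases hxy with ⟨⟨rfl, rfl⟩ | ⟨rfl, rfl⟩, _⟩
  · exact h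
  · exact h.symm

lemma lf_edge {G : SimpleGraph V} {W : Finset V} {m : ℕ} (h : LF G W m) {u v : V}
    (huv : G.Adj u v) (hu : u ∉ W) (hv : v ∉ W) : LF G (insert u (insert v W)) (m + 1) := by
  obtain ⟨H, hle, hlf, hc, hs⟩ := h
  have hu' : {w | H.Adj u w} = ∅ := by
    ext w; simpa using fun h => hu (hs _ _ h)
  obtain ⟨h1, h2⟩ := linforest_ext hlf huv.ne (by simp [hu']) (fun w h => hv (hs _ _ h))
  refine ⟨_, sup_le hle (edge_le_of huv), h1, by omega, ?_⟩
  intro x y hxy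
  simp only [sup_adj, edge_adj] at hxy
  have := hs x y
  grind

lemma lf_cherry {G : SimpleGraph V} {W : Finset V} {m : ℕ} (h : LF G W m) {u v w : V}
    (huv : G.Adj u v) (huw : G.Adj u w) (hvw : v ≠ w) (hu : u ∉ W) (hv : v ∉ W) (hw : w ∉ W) :
    LF G (insert u (insert v (insert w W))) (m + 2) := by
  obtain ⟨H, hle, hlf, hc, hs⟩ := h
  have hu' : {w | H.Adj u w} = ∅ := by
    ext w; simpa using fun h => hu (hs _ _ h)
  obtain ⟨h1, h2⟩ := linforest_ext hlf huv.ne (by simp [hu']) (fun w h => hv (hs _ _ h))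
  have hsub : {z | (H ⊔ edge u v).Adj u z} ⊆ {v} := by
    intro z hz
    simp only [Set.mem_ofPred_eq, sup_adj, edge_adj, Set.mem_singleton_iff] at hz ⊢
    have : ¬ H.Adj u z := fun h => hu (hs _ _ h)
    grind
  have hc1 : {z | (H ⊔ edge u v).Adj u z}.ncard ≤ 1 := by
    simpa using Set.ncard_le_ncard hsub (Set.toFinite _)
  obtain ⟨h3, h4⟩ := linforest_ext h1 huw.ne hc1 (by
    intro z hz
    simp only [sup_adj, edge_adj] at hz
    have : ¬ H.Adj w z := fun h => hw (hs _ _ h)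
    have := huw.ne
    grind)
  refine ⟨_, sup_le (sup_le hle (edge_le_of huv)) (edge_le_of huw), h3, by omega, ?_⟩
  intro x y hxy
  simp only [sup_adj, edge_adj] at hxy
  have := hs x y
  grind

lemma LF.contains {G : SimpleGraph V} {W : Finset V} {m : ℕ} (h : LF G W m) :
    ContainsLinForest G m := by
  obtain ⟨H, hle, hlf, hc, hs⟩ := h
  exact ⟨H, hle, hlf, hc⟩

open Classical in
lemma lf_cherries {G : SimpleGraph V} {W : Finset V} {m : ℕ} (h : LF G W m) (A : Finset V)
    (hA : Disjoint A W) (hd : ∀ u ∈ A, W.card + 3 * A.card ≤ (G.neighborFinset u).card) :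
    ContainsLinForest G (m + 2 * A.card) := by
  suffices H : ∀ C ⊆ A, ∃ W' : Finset V, LF G W' (m + 2 * C.card) ∧
      W'.card ≤ W.card + 3 * C.card ∧ Disjoint (A \ C) W' by
    obtain ⟨W', h1, _⟩ := H A subset_rfl
    exact h1.contains
  intro C
  induction C using Finset.induction_on with
  | empty => exact fun _ => ⟨W, by simpa using h, by simp, by simpa using hA⟩
  | insert u C huC ih =>
    intro hsub
    rw [Finset.insert_subset_iff] at hsub
    obtain ⟨W', h1, h2, h3⟩ := ih hsub.2
    have hCA : C.card + 1 ≤ A.card := by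
      rw [← Finset.card_insert_of_notMem huC]
      exact Finset.card_le_card (Finset.insert_subset_iff.2 hsub)
    have hcard : 1 < (G.neighborFinset u \ (W' ∪ (A \ C))).card := by
      have e1 := Finset.le_card_sdiff (W' ∪ (A \ C)) (G.neighborFinset u)
      have e2 := Finset.card_union_le W' (A \ C)
      have e3 := Finset.card_sdiff_of_subset hsub.2
      have e4 := hd u hsub.1
      omega
    obtain ⟨v, hv, w, hw, hvw⟩ := Finset.one_lt_card.1 hcard
    simp only [Finset.mem_sdiff, mem_neighborFinset, Finset.mem_union, not_or] at hv hw
    have hu : u ∉ W' := Finset.disjoint_left.1 h3 (by simp [hsub.1, huC])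
    refine ⟨_, by
      rw [Finset.card_insert_of_notMem huC, mul_add, ← add_assoc]
      exact lf_cherry h1 hv.1 hw.1 hvw hu hv.2.1 hw.2.1, ?_, ?_⟩
    · rw [Finset.card_insert_of_notMem huC]
      have e1 := Finset.card_insert_le u (insert v (insert w W'))
      have e2 := Finset.card_insert_le v (insert w W')
      have e3 := Finset.card_insert_le w W'
      omega
    · rw [Finset.disjoint_left] at h3 ⊢
      intro z hz
      have := @h3 z
      grind

open Classical in
/-- few high degree vertices -/
lemma high_card {G : SimpleGraph V} {h : ℕ} (hG : ¬ ContainsLinForest G (2 * h)) (A : Finset V)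
    (hA : ∀ u ∈ A, 3 * h ≤ (G.neighborFinset u).card) : A.card < h := by
  by_contra hlt
  push Not at hlt
  obtain ⟨C, hC, hCc⟩ := Finset.exists_subset_card_eq hlt
  apply hG
  have := lf_cherries (lf_bot G ∅) C (by simp) (fun u hu => by
    have := hA u (hC hu); simpa [hCc] using this)
  simpa [hCc] using this

lemma exists_cover {G : SimpleGraph V} {s : ℕ} (hG : ¬ ContainsLinForest G s) :
    ∃ W : Finset V, W.card ≤ 2 * s ∧ ∀ x y, G.Adj x y → x ∈ W ∨ y ∈ W := by
  by_contra! hcon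
  have key : ∀ m ≤ s, ∃ W : Finset V, W.card ≤ 2 * m ∧ LF G W m := by
    intro m
    induction m with
    | zero => exact fun _ => ⟨∅, by simp, lf_bot G ∅⟩
    | succ m ih =>
      intro hm
      obtain ⟨W, hW, hlf⟩ := ih (by omega)
      obtain ⟨x, y, hxy, hx, hy⟩ := hcon W (by omega)
      refine ⟨_, ?_, lf_edge hlf hxy hx hy⟩
      have e2 := Finset.card_insert_le x (insert y W)
      have e3 := Finset.card_insert_le y W
      omega
  obtain ⟨W, _, h⟩ := key s le_rfl
  exact hG h.contains

open Classical in
/-- a full join with two extra edges contains the forest -/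
lemma two_edges {G : SimpleGraph V} {h : ℕ} (hG : ¬ ContainsLinForest G (2 * h)) (A : Finset V)
    (hAc : A.card + 1 = h) (hV : 3 * h + 4 < Fintype.card V)
    (hA : ∀ u ∈ A, ∀ v, u ≠ v → G.Adj u v) {x y z w : V} (hxy : G.Adj x y) (hzw : G.Adj z w)
    (hx : x ∉ A) (hy : y ∉ A) (hz : z ∉ A) (hw : w ∉ A) : (z = x ∧ w = y) ∨ (z = y ∧ w = x) := by
  by_contra hne
  have hbase : ∃ W : Finset V, W.card ≤ 4 ∧ Disjoint A W ∧ LF G W 2 := by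
    have aux : ∀ p q r : V, p ∉ A → q ∉ A → r ∉ A → G.Adj p q → G.Adj p r → q ≠ r →
        ∃ W : Finset V, W.card ≤ 4 ∧ Disjoint A W ∧ LF G W 2 := by
      intro p q r hp hq hr hpq hpr hqr
      refine ⟨_, ?_, ?_, lf_cherry (lf_bot G ∅) hpq hpr hqr (by simp) (by simp) (by simp)⟩
      · exact Finset.card_le_three.trans (by norm_num)
      · simp [Finset.disjoint_right, hp, hq, hr]
    by_cases h1 : z = x
    · subst h1; exact aux z y w hx hy hw hxy hzw (by grind)
    by_cases h2 : z = y
    · subst h2; exact aux z x w hy hx hw hxy.symm hzw (by grind)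
    by_cases h3 : w = x
    · subst h3; exact aux w y z hx hy hz hxy hzw.symm (by grind)
    by_cases h4 : w = y
    · subst h4; exact aux w x z hy hx hz hxy.symm hzw.symm (by grind)
    refine ⟨_, ?_, ?_, lf_edge (lf_edge (lf_bot G ∅) hxy (by simp) (by simp)) hzw
      (by simp [h1, h2]) (by simp [h3, h4])⟩
    · exact Finset.card_le_four
    · simp [Finset.disjoint_right, hx, hy, hz, hw]
  obtain ⟨W, hW, hd, hlf⟩ := hbase
  apply hG
  have := lf_cherries hlf A hd (fun u hu => by
    have : G.neighborFinset u = Finset.univ.erase u := by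
      ext v
      simp only [mem_neighborFinset, Finset.mem_erase, Finset.mem_univ, and_true]
      exact ⟨fun h => h.ne', fun h => hA u hu v h.symm⟩
    rw [this, Finset.card_erase_of_mem (Finset.mem_univ _), Finset.card_univ]
    omega)
  rwa [show 2 + 2 * A.card = 2 * h by omega] at this

def Shape (G : SimpleGraph V) (a : ℕ) : Prop :=
  ∃ (A : Finset V) (u v : V), A.card = a ∧ u ∉ A ∧ v ∉ A ∧ u ≠ v ∧
    ∀ x y, G.Adj x y ↔ x ≠ y ∧ (x ∈ A ∨ y ∈ A ∨ (x = u ∧ y = v) ∨ (x = v ∧ y = u))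

lemma Shape.not_contains {G : SimpleGraph V} {a s : ℕ} (h : Shape G a) (hs : 2 * a + 2 ≤ s) :
    ¬ ContainsLinForest G s := by
  rintro ⟨H, hle, hlf, hc⟩
  obtain ⟨A, u, v, hA, hu, hv, huv, hadj⟩ := h
  have hsub : H.edgeSet ⊆ insert s(u, v) (⋃ x ∈ A, (fun y => s(x, y)) '' {y | H.Adj x y}) := by
    intro e
    induction e with | _ x y =>
    intro he
    rw [mem_edgeSet] at he
    have := ((hadj x y).1 (hle he)).2
    rcases this with h | h | h | h
    · right
      simp only [Set.mem_iUnion]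
      exact ⟨x, h, y, he, rfl⟩
    · right
      simp only [Set.mem_iUnion]
      exact ⟨y, h, x, he.symm, Sym2.eq_swap⟩
    · left; simp [h.1, h.2]
    · left; simp [h.1, h.2, Sym2.eq_swap]
  have h1 := Set.ncard_le_ncard hsub (Set.toFinite _)
  have h2 := Set.ncard_insert_le s(u, v) (⋃ x ∈ A, (fun y => s(x, y)) '' {y | H.Adj x y})
  have h3 : (⋃ x ∈ A, (fun y => s(x, y)) '' {y | H.Adj x y}).ncard ≤ A.card * 2 := by
    refine (Finset.set_ncard_biUnion_le _ _).trans ?_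
    refine Finset.sum_le_card_nsmul _ _ _ ?_
    intro x _
    exact (Set.ncard_image_le (Set.toFinite _)).trans (hlf.2 x)
  omega

lemma Shape.cliqueFree {G : SimpleGraph V} {a k : ℕ} (h : Shape G a) (hk : a + 2 < k) :
    G.CliqueFree k := by
  rintro C ⟨hC, hCc⟩
  obtain ⟨A, u, v, hA, hu, hv, huv, hadj⟩ := h
  have h1 := Finset.le_card_sdiff A C
  obtain ⟨p, hp, q, hq, r, hr, hpq, hpr, hqr⟩ := Finset.two_lt_card.1 (show 2 < (C \ A).card by omega)
  simp only [Finset.mem_sdiff] at hp hq hr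
  have e1 := (hadj p q).1 (hC hp.1 hq.1 hpq)
  have e2 := (hadj p r).1 (hC hp.1 hr.1 hpr)
  have e3 := (hadj q r).1 (hC hq.1 hr.1 hqr)
  grind

lemma Shape.iso {G H : SimpleGraph V} {a : ℕ} (hG : Shape G a) (hH : Shape H a) :
    Nonempty (G ≃g H) := by
  obtain ⟨A, u, v, hA, hu, hv, huv, hadj⟩ := hG
  obtain ⟨A', u', v', hA', hu', hv', huv', hadj'⟩ := hH
  have e : {x // x ∈ A} ≃ {x // x ∈ A'} := Finset.equivOfCardEq (by omega)
  let σ := e.extendSubtype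
  have hσ : ∀ x, σ x ∈ A' ↔ x ∈ A := by
    intro x
    constructor
    · intro h
      by_contra hx
      exact e.extendSubtype_not_mem x hx h
    · exact e.extendSubtype_mem x
  let τ := σ.trans (Equiv.swap (σ u) u')
  have hτu : τ u = u' := by simp [τ]
  have hτ : ∀ x, τ x ∈ A' ↔ x ∈ A := by
    intro x
    rw [← hσ x]
    have h1 : σ u ∉ A' := by rwa [hσ]
    simp only [τ, Equiv.trans_apply, Equiv.swap_apply_def]
    grind
  let π := τ.trans (Equiv.swap (τ v) v')
  have hπv : π v = v' := by simp [π]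
  have hπu : π u = u' := by
    have : τ v ≠ u' := by rw [← hτu]; exact fun h => huv (τ.injective h).symm
    simp only [π, Equiv.trans_apply, hτu]
    exact Equiv.swap_apply_of_ne_of_ne this.symm huv'
  have hπ : ∀ x, π x ∈ A' ↔ x ∈ A := by
    intro x
    rw [← hτ x]
    have h1 : τ v ∉ A' := by rwa [hτ]
    simp only [π, Equiv.trans_apply, Equiv.swap_apply_def]
    grind
  refine ⟨⟨π, ?_⟩⟩
  intro x y
  rw [hadj, hadj', hπ, hπ, ← hπu, ← hπv]
  simp only [π.injective.eq_iff, ne_eq]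

lemma Shape.of_iso {G H : SimpleGraph V} {a : ℕ} (hH : Shape H a) (e : G ≃g H) : Shape G a := by
  obtain ⟨A, u, v, hA, hu, hv, huv, hadj⟩ := hH
  have hm : ∀ x, x ∈ A.map e.symm.toEquiv.toEmbedding ↔ e x ∈ A := by
    intro x
    simp only [Finset.mem_map]
    constructor
    · rintro ⟨b, hb, rfl⟩
      have : e (e.symm b) = b := e.apply_symm_apply b
      exact this.symm ▸ hb
    · intro h; exact ⟨e x, h, e.symm_apply_apply x⟩
  refine ⟨A.map e.symm.toEquiv.toEmbedding, e.symm u, e.symm v, by simpa using hA, ?_, ?_, ?_, ?_⟩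
  · rw [hm]; simpa using hu
  · rw [hm]; simpa using hv
  · simpa using huv
  · intro x y
    have hs : ∀ x b, x = e.symm b ↔ e x = b := by
      intro x b; exact ⟨fun h => by simp [h], fun h => by simp [← h]⟩
    rw [← e.map_adj_iff, hadj, hm, hm, hs, hs, hs, hs]
    simp

end Combi

lemma shape_target (n a : ℕ) (hn : a + 2 ≤ n) : Shape (cliqueEdgeJoinEmpty n a) a := by
  refine ⟨Finset.univ.filter (fun x : Fin n => x.val < a), ⟨a, by omega⟩, ⟨a + 1, by omega⟩,
    ?_, by simp, by simp, by simp, ?_⟩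
  · rw [Fin.card_filter_val_lt]; omega
  · intro x y
    simp only [cliqueEdgeJoinEmpty, fromRel_adj, Finset.mem_filter, Finset.mem_univ, true_and,
      Fin.ext_iff, ne_eq]
    omega

section Spec
variable {V : Type*} [Fintype V] [DecidableEq V]

lemma adjMat_apply (G : SimpleGraph V) (v w : V) [Decidable (G.Adj v w)] :
    adjMat G v w = if G.Adj v w then 1 else 0 := by
  unfold adjMat
  split_ifs <;> simp_all

lemma adjMat_nonneg (G : SimpleGraph V) (v w : V) : 0 ≤ adjMat G v w := by
  classical
  rw [adjMat_apply]; split_ifs <;> norm_num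

lemma adjMat_le_one (G : SimpleGraph V) (v w : V) : adjMat G v w ≤ 1 := by
  classical
  rw [adjMat_apply]; split_ifs <;> norm_num

lemma adjMat_comm (G : SimpleGraph V) (v w : V) : adjMat G v w = adjMat G w v := by
  classical
  rw [adjMat_apply, adjMat_apply]; simp only [G.adj_comm]

lemma adjMat_herm (G : SimpleGraph V) : (adjMat G).IsHermitian := by
  ext v w
  simp [adjMat_comm G v w]

lemma spec_psd (G : SimpleGraph V) :
    (algebraMap ℝ (Matrix V V ℝ) (specRad G) - adjMat G).PosSemidef := by
  rw [posSemidef_iff_isHermitian_and_spectrum_nonneg]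
  refine ⟨?_, ?_⟩
  · refine IsHermitian.sub ?_ (adjMat_herm G)
    rw [Algebra.algebraMap_eq_smul_one]
    ext i j
    simp [Matrix.one_apply, eq_comm]
  · rw [← spectrum.singleton_sub_eq]
    rintro _ ⟨r, hr, t, ht, rfl⟩
    rw [Set.mem_singleton_iff] at hr
    subst hr
    have : t ≤ specRad G := le_csSup ((finite_real_spectrum (A := adjMat G)).bddAbove) ht
    simpa using this

lemma quad_eq (G : SimpleGraph V) (x : V → ℝ) :
    x ⬝ᵥ ((algebraMap ℝ (Matrix V V ℝ) (specRad G) - adjMat G) *ᵥ x) =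
      specRad G * ∑ v, x v * x v - ∑ v, x v * ∑ w, adjMat G v w * x w := by
  rw [Matrix.sub_mulVec, dotProduct_sub, Algebra.algebraMap_eq_smul_one, smul_mulVec, one_mulVec,
    dotProduct_smul]
  rfl

lemma rayleigh (G : SimpleGraph V) (x : V → ℝ) :
    ∑ v, x v * ∑ w, adjMat G v w * x w ≤ specRad G * ∑ v, x v * x v := by
  have := (spec_psd G).dotProduct_mulVec_nonneg x
  rw [star_trivial, quad_eq] at this
  linarith

lemma perron [Nonempty V] (G : SimpleGraph V) : ∃ x : V → ℝ, (∀ v, 0 ≤ x v) ∧ (∃ u, x u = 1) ∧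
    (∀ v, x v ≤ 1) ∧ ∀ v, specRad G * x v = ∑ w, adjMat G v w * x w := by
  have hmem : specRad G ∈ spectrum ℝ (adjMat G) := by
    refine Set.Nonempty.csSup_mem ?_ (finite_real_spectrum (A := adjMat G))
    rw [(adjMat_herm G).spectrum_real_eq_range_eigenvalues]
    exact Set.range_nonempty _
  have hev : Module.End.HasEigenvalue (Matrix.toLin' (adjMat G)) (specRad G) := by
    rw [Module.End.hasEigenvalue_iff_mem_spectrum, Matrix.spectrum_toLin']
    exact hmem
  obtain ⟨z, hz⟩ := hev.exists_hasEigenvector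
  have hz1 : ∀ v, specRad G * z v = ∑ w, adjMat G v w * z w := by
    intro v
    have := congrFun hz.apply_eq_smul v
    rw [Matrix.toLin'_apply] at this
    exact this.symm
  let y : V → ℝ := fun v => |z v|
  have hq : specRad G * ∑ v, y v * y v ≤ ∑ v, y v * ∑ w, adjMat G v w * y w := by
    rw [Finset.mul_sum]
    refine Finset.sum_le_sum fun v _ => ?_
    calc specRad G * (y v * y v) = z v * (specRad G * z v) := by
          simp only [y, abs_mul_abs_self]; ring
      _ = z v * ∑ w, adjMat G v w * z w := by rw [hz1]
      _ ≤ |z v * ∑ w, adjMat G v w * z w| := le_abs_self _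
      _ = y v * |∑ w, adjMat G v w * z w| := abs_mul _ _
      _ ≤ y v * ∑ w, adjMat G v w * y w := by
          refine mul_le_mul_of_nonneg_left ?_ (abs_nonneg _)
          refine (Finset.abs_sum_le_sum_abs _ _).trans (Finset.sum_le_sum fun w _ => ?_)
          rw [abs_mul, abs_of_nonneg (adjMat_nonneg G v w)]
  have h0 : star y ⬝ᵥ ((algebraMap ℝ (Matrix V V ℝ) (specRad G) - adjMat G) *ᵥ y) = 0 := by
    rw [star_trivial, quad_eq]
    linarith [rayleigh G y]
  rw [(spec_psd G).dotProduct_mulVec_zero_iff] at h0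
  have hy : ∀ v, specRad G * y v = ∑ w, adjMat G v w * y w := by
    intro v
    have := congrFun h0 v
    rw [Matrix.sub_mulVec, Algebra.algebraMap_eq_smul_one, smul_mulVec, one_mulVec] at this
    have h2 : specRad G * y v - ∑ w, adjMat G v w * y w = 0 := this
    linarith
  obtain ⟨u, -, hu⟩ := Finset.exists_max_image Finset.univ y Finset.univ_nonempty
  have hpos : 0 < y u := by
    by_contra hle
    apply hz.2
    funext v
    have h1 := hu v (Finset.mem_univ _)
    have : |z v| ≤ 0 := by simp only [y] at h1 hle; linarith
    simpa using this
  refine ⟨fun v => y v / y u, fun v => div_nonneg (abs_nonneg _) hpos.le, ⟨u, div_self hpos.ne'⟩,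
    fun v => (div_le_one hpos).2 (hu v (Finset.mem_univ _)), fun v => ?_⟩
  rw [← mul_div_assoc, hy, Finset.sum_div]
  simp only [mul_div_assoc]

lemma specRad_iso {G H : SimpleGraph V} (e : G ≃g H) : specRad G = specRad H := by
  unfold specRad
  rw [← AlgEquiv.spectrum_eq (Matrix.reindexAlgEquiv ℝ ℝ e.toEquiv) (adjMat G)]
  congr 2
  ext v w
  classical
  simp only [coe_reindexAlgEquiv, reindex_apply, submatrix_apply]
  rw [adjMat_apply, adjMat_apply]
  congr 1
  exact propext (e.symm.map_adj_iff)

lemma shape_lower {G : SimpleGraph V} {a : ℕ} (hG : Shape G a) (ha : 1 ≤ a) {r : ℝ} (hr : 0 < r)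
    (hr2 : r * r = (a - 1) * r + a * ((Fintype.card V : ℝ) - a)) : r < specRad G := by
  classical
  obtain ⟨A, p, q, hA, hp, hq, hpq, hadj⟩ := hG
  have ha' : (0 : ℝ) < a := by exact_mod_cast ha
  let y : V → ℝ := fun v => if v ∈ A then r else a
  have hypos : ∀ v, 0 < y v := by intro v; simp only [y]; split_ifs <;> assumption
  have hAsum : ∑ w ∈ A, y w = a * r := by
    rw [Finset.sum_congr rfl (g := fun _ => r) (fun w hw => by simp [y, hw])]
    simp [hA]
  have hBsum : ∑ w ∈ Aᶜ, y w = (Fintype.card V - a) * a := by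
    rw [Finset.sum_congr rfl (g := fun _ => (a : ℝ)) (fun w hw => by
      rw [Finset.mem_compl] at hw; simp [y, hw])]
    rw [Finset.sum_const, Finset.card_compl, hA, nsmul_eq_mul, Nat.cast_sub]
    rw [← hA]; exact Finset.card_le_univ A
  have hsumA : ∀ v ∉ A, ∑ w ∈ A, adjMat G v w * y w = a * r := by
    intro v hv
    rw [← hAsum]
    refine Finset.sum_congr rfl fun w hw => ?_
    rw [adjMat_apply, if_pos, one_mul]
    rw [hadj]
    exact ⟨fun h => hv (h ▸ hw), Or.inr (Or.inl hw)⟩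
  have h1 : ∀ v, r * y v ≤ ∑ w, adjMat G v w * y w := by
    intro v
    by_cases hv : v ∈ A
    · have e1 : ∑ w, adjMat G v w * y w = ∑ w, y w - y v := by
        rw [← Finset.sum_erase_eq_sub (Finset.mem_univ v),
          ← Finset.sum_erase_add _ _ (Finset.mem_univ v)]
        have : adjMat G v v = 0 := by rw [adjMat_apply]; simp
        rw [this, zero_mul, add_zero]
        refine Finset.sum_congr rfl fun w hw => ?_
        rw [adjMat_apply, if_pos, one_mul]
        rw [hadj]
        exact ⟨(Finset.ne_of_mem_erase hw).symm, Or.inl hv⟩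
      rw [e1, ← Finset.sum_add_sum_compl A, hAsum, hBsum]
      simp only [y, hv, if_true]
      linarith
    · rw [← Finset.sum_add_sum_compl A, hsumA v hv]
      have : 0 ≤ ∑ w ∈ Aᶜ, adjMat G v w * y w :=
        Finset.sum_nonneg fun w _ => mul_nonneg (adjMat_nonneg _ _ _) (hypos w).le
      simp only [y, hv, if_false] at this ⊢
      linarith
  have h2 : r * y p < ∑ w, adjMat G p w * y w := by
    rw [← Finset.sum_add_sum_compl A, hsumA p hp]
    have : adjMat G p q * y q ≤ ∑ w ∈ Aᶜ, adjMat G p w * y w :=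
      Finset.single_le_sum (f := fun w => adjMat G p w * y w)
        (fun w _ => mul_nonneg (adjMat_nonneg _ _ _) (hypos w).le) (by simpa using hq)
    rw [adjMat_apply, if_pos ((hadj p q).2 ⟨hpq, by simp⟩), one_mul] at this
    have h3 := hypos q
    simp only [y, hp, if_false] at this h3 ⊢
    linarith
  have h3 : r * ∑ v, y v * y v < ∑ v, y v * ∑ w, adjMat G v w * y w := by
    rw [Finset.mul_sum]
    refine Finset.sum_lt_sum (fun v _ => ?_) ⟨p, Finset.mem_univ _, ?_⟩
    · have := mul_le_mul_of_nonneg_left (h1 v) (hypos v).le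
      linarith
    · have := mul_lt_mul_of_pos_left h2 (hypos p)
      linarith
  have h4 := h3.trans_le (rayleigh G y)
  have h5 : 0 ≤ ∑ v, y v * y v := Finset.sum_nonneg fun v _ => mul_self_nonneg _
  exact lt_of_mul_lt_mul_right h4 h5

end Spec

section Core
variable {V : Type*} [Fintype V] [DecidableEq V]

open Classical in
lemma sum_adjMat (G : SimpleGraph V) (v : V) :
    ∑ w, adjMat G v w = (G.neighborFinset v).card := by
  rw [Finset.sum_congr rfl (g := fun w => if w ∈ G.neighborFinset v then (1 : ℝ) else 0)
    (fun w _ => by rw [adjMat_apply]; simp)]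
  rw [Finset.sum_ite_mem, Finset.univ_inter]
  simp

set_option maxHeartbeats 2000000 in
lemma core {G : SimpleGraph V} {a : ℕ} (ha : 1 ≤ a)
    (hV : 36288 * (a + 1) ^ 8 ≤ Fintype.card V)
    (hG : ¬ ContainsLinForest G (2 * (a + 1))) {r : ℝ} (hr : 0 < r)
    (hr2 : r * r = (a - 1) * r + a * ((Fintype.card V : ℝ) - a)) (hlt : r < specRad G) :
    Shape G a := by
  classical
  set lam := specRad G with hlam
  set N : ℝ := (Fintype.card V : ℝ) with hN
  obtain ⟨h, hh⟩ : ∃ h : ℝ, h = a + 1 := ⟨_, rfl⟩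
  have ha1 : (1 : ℝ) ≤ a := by exact_mod_cast ha
  have hh2 : 2 ≤ h := by linarith
  have hNh : 36288 * h ^ 8 ≤ N := by rw [hh, hN]; exact_mod_cast hV
  have hp2 : h ≤ h ^ 2 := by nlinarith
  have hp3 : h ≤ h ^ 3 := by nlinarith
  have hp6 : h ^ 2 ≤ h ^ 6 := pow_le_pow_right₀ (by linarith) (by norm_num)
  have hp8 : h ^ 6 ≤ h ^ 8 := pow_le_pow_right₀ (by linarith) (by norm_num)
  have hrbig : 150 * h ^ 3 < r := by
    by_contra hle
    push Not at hle
    have h1 : r * r ≤ (150 * h ^ 3) * (150 * h ^ 3) := mul_le_mul hle hle hr.le (by positivity)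
    have h2 : N - a ≤ a * (N - a) := by nlinarith
    have h3 : 0 ≤ (a - 1) * r := mul_nonneg (by linarith) hr.le
    nlinarith
  have hlbig : 150 * h ^ 3 < lam := hrbig.trans hlt
  have hlpos : 0 < lam := hr.trans hlt
  have hq : (a - 1) * lam + a * (N - a) < lam * lam := by
    have : 0 < (lam - r) * (lam + r - (a - 1)) := mul_pos (by linarith) (by linarith)
    nlinarith
  have : Nonempty V := by
    rw [← Fintype.card_pos_iff]
    have : 0 < (a + 1) ^ 8 := by positivity
    omega
  obtain ⟨x, hx0, ⟨us, hus⟩, hx1, heig⟩ := perron G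
  rw [← hlam] at heig
  set c := adjMat G with hc
  have hc0 : ∀ v w, 0 ≤ c v w := adjMat_nonneg G
  have hc1 : ∀ v w, c v w ≤ 1 := adjMat_le_one G
  have hterm : ∀ v w, c v w * x w ≤ c v w := fun v w => mul_le_of_le_one_right (hc0 v w) (hx1 w)
  have hdeg : ∀ v, lam * x v ≤ (G.neighborFinset v).card := by
    intro v
    rw [heig, ← sum_adjMat]
    exact Finset.sum_le_sum fun w _ => hterm v w
  let A : Finset V := Finset.univ.filter fun v => 3 * (a + 1) ≤ (G.neighborFinset v).card
  have hAmem : ∀ v, v ∈ A ↔ 3 * (a + 1) ≤ (G.neighborFinset v).card := by 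
    intro v; exact Finset.mem_filter.trans (and_iff_right (Finset.mem_univ v))
  have hAcard : A.card ≤ a := by
    have := high_card hG A (fun u hu => (hAmem u).1 hu)
    omega
  have hBdeg : ∀ v ∈ Aᶜ, ((G.neighborFinset v).card : ℝ) ≤ 3 * h := by
    intro v hv
    rw [Finset.mem_compl, hAmem] at hv
    rw [hh]
    have : (G.neighborFinset v).card ≤ 3 * (a + 1) := by omega
    exact_mod_cast this
  have hBx : ∀ v ∈ Aᶜ, x v ≤ 3 * h / lam := by
    intro v hv
    rw [le_div_iff₀ hlpos]
    linarith [hdeg v, hBdeg v hv]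
  have husA : us ∈ A := by
    by_contra hn
    have h1 := hBdeg us (by simpa using hn)
    have h2 := hdeg us
    rw [hus] at h2
    nlinarith
  -- the number of edges inside the complement of A
  obtain ⟨W, hWc, hW⟩ := exists_cover hG
  have hrow : ∀ v ∈ Aᶜ, ∑ w ∈ Aᶜ, c v w ≤ 3 * h := by
    intro v hv
    refine le_trans ?_ (hBdeg v hv)
    rw [← sum_adjMat]
    exact Finset.sum_le_sum_of_subset_of_nonneg (Finset.subset_univ _) fun w _ _ => hc0 v w
  have hWB : ∑ v ∈ Aᶜ, ∑ w ∈ Aᶜ, (if v ∈ W then c v w else 0) ≤ 12 * h ^ 2 := by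
    calc ∑ v ∈ Aᶜ, ∑ w ∈ Aᶜ, (if v ∈ W then c v w else 0)
        = ∑ v ∈ Aᶜ, (if v ∈ W then ∑ w ∈ Aᶜ, c v w else 0) := by
          refine Finset.sum_congr rfl fun v _ => ?_
          split_ifs <;> simp
      _ ≤ ∑ v ∈ Aᶜ, (if v ∈ W then 3 * h else 0) := by
          refine Finset.sum_le_sum fun v hv => ?_
          split_ifs
          · exact hrow v hv
          · exact le_rfl
      _ = ((Aᶜ ∩ W).card : ℝ) * (3 * h) := by
          rw [Finset.sum_ite_mem, Finset.sum_const, nsmul_eq_mul]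
      _ ≤ (4 * h) * (3 * h) := by
          refine mul_le_mul_of_nonneg_right ?_ (by linarith)
          have : (Aᶜ ∩ W).card ≤ 4 * (a + 1) :=
            (Finset.card_le_card Finset.inter_subset_right).trans (by omega)
          rw [hh]; exact_mod_cast this
      _ = 12 * h ^ 2 := by ring
  have hcB : ∑ v ∈ Aᶜ, ∑ w ∈ Aᶜ, c v w ≤ 24 * h ^ 2 := by
    have h1 : ∑ v ∈ Aᶜ, ∑ w ∈ Aᶜ, c v w ≤ ∑ v ∈ Aᶜ, ∑ w ∈ Aᶜ, (if v ∈ W then c v w else 0) +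
        ∑ v ∈ Aᶜ, ∑ w ∈ Aᶜ, (if w ∈ W then c w v else 0) := by
      rw [← Finset.sum_add_distrib]
      refine Finset.sum_le_sum fun v _ => ?_
      rw [← Finset.sum_add_distrib]
      refine Finset.sum_le_sum fun w _ => ?_
      have e1 := hc0 v w
      have e2 : c v w = c w v := adjMat_comm G v w
      by_cases hvw : G.Adj v w
      · rcases hW v w hvw with hh | hh
        · rw [if_pos hh]; split_ifs <;> linarith
        · rw [if_pos hh]; split_ifs <;> linarith
      · have : c v w = 0 := by rw [hc, adjMat_apply, if_neg hvw]
        rw [this]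
        split_ifs <;> linarith
    rw [Finset.sum_comm (f := fun v w => if w ∈ W then c w v else 0)] at h1
    linarith
  obtain ⟨E, hE⟩ : ∃ E, E = ∑ v ∈ Aᶜ, ∑ w ∈ Aᶜ, c v w * x w := ⟨_, rfl⟩
  have hEle : E < 1 / 2 := by
    have h1 : E ≤ 24 * h ^ 2 * (3 * h / lam) := by
      calc E ≤ ∑ v ∈ Aᶜ, ∑ w ∈ Aᶜ, c v w * (3 * h / lam) := by
            rw [hE]
            exact Finset.sum_le_sum fun v _ => Finset.sum_le_sum fun w hw =>
              mul_le_mul_of_nonneg_left (hBx w hw) (hc0 v w)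
        _ = (∑ v ∈ Aᶜ, ∑ w ∈ Aᶜ, c v w) * (3 * h / lam) := by
            simp only [Finset.sum_mul]
        _ ≤ _ := mul_le_mul_of_nonneg_right hcB (by positivity)
    refine h1.trans_lt ?_
    rw [← mul_div_assoc, div_lt_iff₀ hlpos]
    nlinarith
  obtain ⟨SA, hSA⟩ : ∃ S, S = ∑ w ∈ A, x w := ⟨_, rfl⟩
  obtain ⟨SB, hSB⟩ : ∃ S, S = ∑ w ∈ Aᶜ, x w := ⟨_, rfl⟩
  have hSA0 : 0 ≤ SA := hSA ▸ Finset.sum_nonneg fun w _ => hx0 w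
  have hSB0 : 0 ≤ SB := hSB ▸ Finset.sum_nonneg fun w _ => hx0 w
  obtain ⟨m1, hm1⟩ : ∃ m, m = ∑ v ∈ Aᶜ, ∑ w ∈ A, (1 - c v w) * x w := ⟨_, rfl⟩
  have hm1t : ∀ v w, 0 ≤ (1 - c v w) * x w := fun v w =>
    mul_nonneg (by linarith [hc1 v w]) (hx0 w)
  have hm10 : 0 ≤ m1 := hm1 ▸ Finset.sum_nonneg fun v _ => Finset.sum_nonneg fun w _ => hm1t v w
  have hBcard : ((Aᶜ.card : ℕ) : ℝ) = N - A.card := by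
    rw [Finset.card_compl, Nat.cast_sub (Finset.card_le_univ A)]
  have eqB : lam * SB = (N - A.card) * SA - m1 + E := by
    have : ∑ v ∈ Aᶜ, ∑ w ∈ A, x w = (N - A.card) * SA := by
      rw [Finset.sum_const, nsmul_eq_mul, hBcard, hSA]
    rw [← this, hm1, hE, hSB, Finset.mul_sum, ← Finset.sum_sub_distrib, ← Finset.sum_add_distrib]
    refine Finset.sum_congr rfl fun v _ => ?_
    rw [heig, ← Finset.sum_add_sum_compl A, ← Finset.sum_sub_distrib]
    congr 1
    exact Finset.sum_congr rfl fun w _ => by ring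
  -- bounding below the entries on A
  have hus1 : lam ≤ (a - 1) + SB := by
    have h1 := heig us
    rw [hus, mul_one, ← Finset.sum_add_sum_compl A, ← Finset.sum_erase_add _ _ husA] at h1
    have h2 : c us us = 0 := by rw [hc, adjMat_apply]; simp
    have h3 : ∑ w ∈ Aᶜ, c us w * x w ≤ SB := by
      rw [hSB]
      exact Finset.sum_le_sum fun w _ => mul_le_of_le_one_left (hx0 w) (hc1 us w)
    have h4 : ∑ w ∈ A.erase us, c us w * x w ≤ (A.erase us).card • (1 : ℝ) :=
      Finset.sum_le_card_nsmul _ _ _ fun w _ => (hterm us w).trans (hc1 us w)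
    have h5 : (A.erase us).card + 1 ≤ a := by
      rw [Finset.card_erase_add_one husA]; exact hAcard
    have h6 : ((A.erase us).card : ℝ) + 1 ≤ a := by exact_mod_cast h5
    rw [nsmul_eq_mul, mul_one] at h4
    rw [h2, zero_mul, add_zero] at h1
    linarith
  have hAc0 : (0 : ℝ) ≤ A.card := Nat.cast_nonneg _
  have hNpos : 0 < N := by linarith
  have hSAbig : a - 1 / 2 < SA := by
    have h1 : lam * lam ≤ (a - 1) * lam + N * SA + E := by
      have f1 := mul_le_mul_of_nonneg_left hus1 hlpos.le
      have f2 := mul_nonneg hAc0 hSA0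
      linarith
    have h2 : a * (N - a) < N * SA + 1 / 2 := by linarith
    have h3 : (a : ℝ) * a + 1 / 2 < N / 2 := by
      have f1 : (a : ℝ) * a ≤ h ^ 2 := by rw [hh]; nlinarith
      linarith
    have h4 : N * (a - 1 / 2) < N * SA := by linarith
    exact lt_of_mul_lt_mul_left h4 hNpos.le
  have hSAle : SA ≤ A.card := by
    have := Finset.sum_le_card_nsmul A x 1 (fun w _ => hx1 w)
    rw [nsmul_eq_mul, mul_one] at this
    rw [hSA]; exact this
  have hAeq : A.card = a := by
    apply le_antisymm hAcard
    have : (a : ℝ) < A.card + 1 := by linarith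
    have : a < A.card + 1 := by exact_mod_cast this
    omega
  have hAeq' : (A.card : ℝ) = a := by rw [hAeq]
  have hxA : ∀ u ∈ A, 1 / 2 < x u := by
    intro u hu
    have h1 : ∑ w ∈ A.erase u, x w ≤ (A.erase u).card • (1 : ℝ) :=
      Finset.sum_le_card_nsmul _ _ _ fun w _ => hx1 w
    have h2 : ((A.erase u).card : ℝ) + 1 = a := by
      rw [← hAeq']; exact_mod_cast Finset.card_erase_add_one hu
    have h3 := Finset.sum_erase_add A x hu
    rw [nsmul_eq_mul, mul_one] at h1
    linarith
  -- the second equation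
  obtain ⟨m2, hm2⟩ : ∃ m, m = ∑ v ∈ A, ∑ w ∈ A, (1 - (if w = v then 1 else 0) - c v w) * x w :=
    ⟨_, rfl⟩
  have hm2t : ∀ v w, 0 ≤ (1 - (if w = v then 1 else 0) - c v w) * x w := by
    intro v w
    refine mul_nonneg ?_ (hx0 w)
    split_ifs with hwv
    · subst hwv
      have : c w w = 0 := by rw [hc, adjMat_apply]; simp
      rw [this]; norm_num
    · linarith [hc1 v w]
  have hm20 : 0 ≤ m2 := hm2 ▸ Finset.sum_nonneg fun v _ => Finset.sum_nonneg fun w _ => hm2t v w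
  have eqA : lam * SA ≤ a * SB + (a - 1) * SA - m2 := by
    have e1 : ∑ v ∈ A, ∑ w ∈ Aᶜ, x w = a * SB := by
      rw [Finset.sum_const, nsmul_eq_mul, hAeq, hSB]
    have e2 : ∑ v ∈ A, (SA - x v) = (a - 1) * SA := by
      rw [Finset.sum_sub_distrib, Finset.sum_const, nsmul_eq_mul, hAeq, ← hSA]; ring
    rw [← e1, ← e2, hm2]
    rw [← Finset.sum_add_distrib, ← Finset.sum_sub_distrib]
    conv_lhs => rw [hSA, Finset.mul_sum]
    refine Finset.sum_le_sum fun v hv => ?_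
    rw [heig, ← Finset.sum_add_sum_compl A]
    have e3 : ∑ w ∈ Aᶜ, c v w * x w ≤ ∑ w ∈ Aᶜ, x w :=
      Finset.sum_le_sum fun w _ => mul_le_of_le_one_left (hx0 w) (hc1 v w)
    have e4 : ∑ w ∈ A, (1 - (if w = v then 1 else 0) - c v w) * x w =
        SA - x v - ∑ w ∈ A, c v w * x w := by
      have : ∑ w ∈ A, (if w = v then (1 : ℝ) else 0) * x w = x v := by
        simp [hv]
      rw [hSA]
      rw [← this]
      rw [← Finset.sum_sub_distrib, ← Finset.sum_sub_distrib]
      exact Finset.sum_congr rfl fun w _ => by ring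
    rw [e4]
    linarith
  have hSApos : 0 < SA := by linarith
  have hmain : a * m1 + lam * m2 < a * E := by
    rw [hAeq'] at eqB
    have h1 : lam * (lam * SA) ≤ lam * (a * SB + (a - 1) * SA - m2) :=
      mul_le_mul_of_nonneg_left eqA hlpos.le
    have h2 : ((a - 1) * lam + a * (N - a)) * SA < lam * lam * SA :=
      mul_lt_mul_of_pos_right hq hSApos
    have h3 : lam * (a * SB + (a - 1) * SA - m2) = a * (lam * SB) + (a - 1) * lam * SA - lam * m2 := by
      ring
    rw [h3, eqB] at h1
    nlinarith
  have halam : (a : ℝ) ≤ lam := by linarith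
  have hm1lt : m1 < 1 / 2 := by
    have : a * m1 < a * (1 / 2) := by nlinarith
    exact lt_of_mul_lt_mul_left this (by linarith)
  have hm2lt : m2 < 1 / 2 := by
    have h1 : a * m2 ≤ lam * m2 := mul_le_mul_of_nonneg_right halam hm20
    have : a * m2 < a * (1 / 2) := by nlinarith
    exact lt_of_mul_lt_mul_left this (by linarith)
  have hEpos : 0 < E := by
    have : 0 < a * E := by nlinarith
    exact pos_of_mul_pos_right this (by linarith)
  have hfull : ∀ u ∈ A, ∀ v, u ≠ v → G.Adj u v := by
    intro u hu v huv
    by_contra hna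
    have hcvu : c v u = 0 := by
      rw [hc, adjMat_apply, if_neg]; exact fun h => hna h.symm
    have hxu := hxA u hu
    by_cases hv : v ∈ A
    · have h1 : ∑ w ∈ A, (1 - (if w = v then 1 else 0) - c v w) * x w ≤ m2 := by
        rw [hm2]
        exact Finset.single_le_sum
          (f := fun v => ∑ w ∈ A, (1 - (if w = v then 1 else 0) - c v w) * x w)
          (fun v _ => Finset.sum_nonneg fun w _ => hm2t v w) hv
      have h2 : (1 - (if u = v then 1 else 0) - c v u) * x u ≤
          ∑ w ∈ A, (1 - (if w = v then 1 else 0) - c v w) * x w :=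
        Finset.single_le_sum (f := fun w => (1 - (if w = v then 1 else 0) - c v w) * x w)
          (fun w _ => hm2t v w) hu
      rw [if_neg huv, hcvu] at h2
      linarith
    · have h1 : ∑ w ∈ A, (1 - c v w) * x w ≤ m1 := by
        rw [hm1]
        exact Finset.single_le_sum (f := fun v => ∑ w ∈ A, (1 - c v w) * x w)
          (fun v _ => Finset.sum_nonneg fun w _ => hm1t v w) (by simpa using hv)
      have h2 : (1 - c v u) * x u ≤ ∑ w ∈ A, (1 - c v w) * x w :=
        Finset.single_le_sum (f := fun w => (1 - c v w) * x w) (fun w _ => hm1t v w) hu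
      rw [hcvu] at h2
      linarith
  have hedge : ∃ p q, p ∉ A ∧ q ∉ A ∧ G.Adj p q := by
    by_contra! hno
    have : E = 0 := by
      rw [hE]
      refine Finset.sum_eq_zero fun v hv => Finset.sum_eq_zero fun w hw => ?_
      rw [Finset.mem_compl] at hv hw
      rw [hc, adjMat_apply, if_neg (hno v w hv hw), zero_mul]
    linarith
  obtain ⟨p, q, hp, hq', hpq⟩ := hedge
  refine ⟨A, p, q, hAeq, hp, hq', hpq.ne, fun y z => ⟨fun hyz => ⟨hyz.ne, ?_⟩, ?_⟩⟩
  · by_cases hy : y ∈ A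
    · exact Or.inl hy
    by_cases hz : z ∈ A
    · exact Or.inr (Or.inl hz)
    right; right
    refine two_edges hG A (by omega) ?_ hfull hpq hyz hp hq' hy hz
    have : a + 1 ≤ (a + 1) ^ 8 := Nat.le_self_pow (by norm_num) _
    omega
  · rintro ⟨hne, hy | hz | ⟨rfl, rfl⟩ | ⟨rfl, rfl⟩⟩
    · exact hfull y hy z hne
    · exact (hfull z hz y hne.symm).symm
    · exact hpq
    · exact hpq.symm

end Core

/-- For `k ≥ 2`, `s ≥ 4` even with `s ≤ 2k - 2` and `n ≥ 36288 ⌊(s+1)/2⌋⁸`, the unique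
`{K_{k+1}, 𝓛_s}`-free graph on `n` vertices of maximum spectral radius is
`K_{s/2-1} ∨ (P_2 ∪ K̄_{n-s/2-1})`. -/
theorem spectral_extremal_even_small (k s n : ℕ) (hk : 2 ≤ k) (hs : 4 ≤ s) (heven : Even s)
    (hsk : s ≤ 2 * k - 2) (hn : 36288 * ((s + 1) / 2) ^ 8 ≤ n) (G : SimpleGraph (Fin n)) :
    IsExtremal n k s G ↔ Nonempty (G ≃g cliqueEdgeJoinEmpty n (s / 2 - 1)) := by
  obtain ⟨a, rfl⟩ : ∃ a, s = 2 * (a + 1) := by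
    obtain ⟨t, ht⟩ := heven
    exact ⟨t - 1, by omega⟩
  have e1 : 2 * (a + 1) / 2 - 1 = a := by omega
  have e2 : (2 * (a + 1) + 1) / 2 = a + 1 := by omega
  rw [e1]
  rw [e2] at hn
  have ha : 1 ≤ a := by omega
  have hpow : a + 1 ≤ (a + 1) ^ 8 := Nat.le_self_pow (by norm_num) _
  have hT : Shape (cliqueEdgeJoinEmpty n a) a := shape_target n a (by omega)
  obtain ⟨r, hr, hr2⟩ : ∃ r : ℝ, 0 < r ∧
      r * r = (a - 1) * r + a * ((Fintype.card (Fin n) : ℝ) - a) := by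
    rw [Fintype.card_fin]
    have ha1 : (1 : ℝ) ≤ a := by exact_mod_cast ha
    have hna : (a : ℝ) < n := by exact_mod_cast (by omega : a < n)
    have hpos : (0 : ℝ) < a * (n - a) := mul_pos (by linarith) (by linarith)
    have hd : (0 : ℝ) < ((a : ℝ) - 1) ^ 2 + 4 * (a * (n - a)) := by positivity
    have hsq := Real.mul_self_sqrt hd.le
    have hsp := Real.sqrt_pos.2 hd
    refine ⟨((a - 1) + √(((a : ℝ) - 1) ^ 2 + 4 * (a * (n - a)))) / 2, by linarith, by nlinarith⟩
  have hTr := shape_lower hT ha hr hr2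
  have hcore : ∀ H : SimpleGraph (Fin n), ¬ ContainsLinForest H (2 * (a + 1)) →
      r < specRad H → Shape H a := fun H hH hlt =>
    core ha (by rwa [Fintype.card_fin]) hH hr hr2 hlt
  constructor
  · rintro ⟨_, h2, h3⟩
    have := h3 _ (hT.cliqueFree (by omega)) (hT.not_contains (by omega))
    exact (hcore G h2 (hTr.trans_le this)).iso hT
  · rintro ⟨e⟩
    have hGs := hT.of_iso e
    refine ⟨hGs.cliqueFree (by omega), hGs.not_contains (by omega), fun H _ hH => ?_⟩
    by_contra hlt
    push Not at hlt
    rw [specRad_iso e] at hlt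
    obtain ⟨e'⟩ := (hcore H hH (hTr.trans hlt)).iso hT
    rw [specRad_iso e'] at hlt
    exact lt_irrefl _ hlt
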